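/- Let σ, s, c > 0 and define D(p) = 1 − Q(√(p/σ²)) for p > 0, where Q(t) = (1/√(2π)) ∫ₜ^∞ exp(−u²/2) du. Then the expected utility U(p) = s·D(p) − c·p has a unique stationary point p* > 0, characterized by exp(−p*/(2σ²)) / (2σ√(2π·p*)) = c/s; moreover U'(p) > 0 for 0 < p < p* and U'(p) < 0 for p > p*, so p* is the unique global maximizer of U on (0, ∞). -/

import Mathlib

open MeasureTheory Set in
theorem hasDerivAt_integral_Ioi {f : ℝ → ℝ} (hf : Continuous f) (hint : Integrable f) (t : ℝ) :
    HasDerivAt (fun t => ∫ u in Ioi t, f u) (-f t) t := by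
  have h : (fun t => ∫ u in Ioi t, f u) = fun t => (∫ u in Ioi 0, f u) - ∫ u in (0 : ℝ)..t, f u := by
    funext t
    rw [← intervalIntegral.integral_Ioi_sub_Ioi' hint.integrableOn hint.integrableOn]
    ring
  rw [h]
  exact (hf.integral_hasStrictDerivAt 0 t).hasDerivAt.const_sub _

theorem hasDerivAt_sqrt_div_sq {σ p : ℝ} (hσ : 0 < σ) (hp : 0 < p) :
    HasDerivAt (fun p => √(p / σ ^ 2)) (1 / (2 * σ * √p)) p := by
  have h := ((hasDerivAt_id p).div_const (σ ^ 2)).sqrt (by positivity)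
  refine h.congr_deriv ?_
  have hsp : 0 < √p := Real.sqrt_pos.mpr hp
  simp only [id, Real.sqrt_div hp.le, Real.sqrt_sq hσ.le]
  field_simp

/-- The derivative of the detection probability `1 - Q(√(p/σ²))`. -/
theorem hasDerivAt_one_sub_gaussian_tail {σ p : ℝ} (hσ : 0 < σ) (hp : 0 < p) :
    HasDerivAt (fun p => 1 - (√(2 * Real.pi))⁻¹ *
        ∫ u in Set.Ioi √(p / σ ^ 2), Real.exp (-(u ^ 2) / 2))
      (Real.exp (-p / (2 * σ ^ 2)) / (2 * σ * √(2 * Real.pi * p))) p := by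
  have hint : MeasureTheory.Integrable fun u : ℝ => Real.exp (-(u ^ 2) / 2) := by
    convert integrable_exp_neg_mul_sq (b := 1 / 2) (by norm_num) using 3
    ring
  have h := (((hasDerivAt_integral_Ioi (by fun_prop) hint _).comp p
    (hasDerivAt_sqrt_div_sq hσ hp)).const_mul (√(2 * Real.pi))⁻¹).const_sub 1
  refine h.congr_deriv ?_
  have hsp : 0 < √p := Real.sqrt_pos.mpr hp
  have h2 : 0 < √(2 * Real.pi) := Real.sqrt_pos.mpr (by positivity)
  have he : -(p / σ ^ 2) / 2 = -p / (2 * σ ^ 2) := by field_simp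
  rw [Real.sq_sqrt (by positivity), he, Real.sqrt_mul (by positivity) p]
  field_simp

theorem strictMonoOn_sqrt_mul_exp {σ : ℝ} (hσ : 0 < σ) :
    StrictMonoOn (fun p => 2 * σ * √(2 * Real.pi * p) * Real.exp (p / (2 * σ ^ 2)))
      (Set.Ici 0) := by
  intro a ha b _ hab
  have ha : 0 ≤ a := ha
  have := Real.pi_pos
  have h1 : √(2 * Real.pi * a) < √(2 * Real.pi * b) :=
    Real.sqrt_lt_sqrt (by positivity) (by gcongr)
  have h2 : Real.exp (a / (2 * σ ^ 2)) < Real.exp (b / (2 * σ ^ 2)) := by gcongr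
  dsimp only
  gcongr

theorem exists_pos_sqrt_mul_exp_eq {σ k : ℝ} (hσ : 0 < σ) (hk : 0 < k) :
    ∃ p, 0 < p ∧ 2 * σ * √(2 * Real.pi * p) * Real.exp (p / (2 * σ ^ 2)) = k := by
  set b := (k / (2 * σ)) ^ 2 with hb
  have hb0 : 0 ≤ b := by positivity
  have hlarge : k ≤ 2 * σ * √(2 * Real.pi * b) * Real.exp (b / (2 * σ ^ 2)) := by
    have h1 : k / (2 * σ) ≤ √(2 * Real.pi * b) :=
      Real.le_sqrt_of_sq_le (by nlinarith [Real.pi_gt_three])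
    have h2 : 1 ≤ Real.exp (b / (2 * σ ^ 2)) := Real.one_le_exp (by positivity)
    calc k = 2 * σ * (k / (2 * σ)) * 1 := by field_simp
      _ ≤ _ := by gcongr
  obtain ⟨p, hp, hpk⟩ := intermediate_value_Icc hb0
    (f := fun p => 2 * σ * √(2 * Real.pi * p) * Real.exp (p / (2 * σ ^ 2)))
    (by fun_prop) ⟨by simpa using hk.le, hlarge⟩
  refine ⟨p, hp.1.lt_of_ne ?_, hpk⟩
  rintro rfl
  exact hk.ne (by simpa using hpk)

/-- With `D(p) = 1 − Q(√(p/σ²))`, the expected utility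
`U(p) = s·D(p) − c·p` has a unique stationary point `pstar > 0`, characterized by
`exp(−pstar/(2σ²)) / (2σ√(2π·pstar)) = c/s`; moreover `U' > 0` on `(0, pstar)` and
`U' < 0` on `(pstar, ∞)`, so `pstar` is the unique global maximizer of `U` on `(0, ∞)`. -/
theorem expected_utility_unique_stationary_global_max
    (σ s c : ℝ) (hσ : 0 < σ) (hs : 0 < s) (hc : 0 < c)
    (Q D U : ℝ → ℝ)
    (hQ : ∀ t, Q t = (Real.sqrt (2 * Real.pi))⁻¹ * ∫ u in Set.Ioi t, Real.exp (-(u ^ 2) / 2))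
    (hD : ∀ p, D p = 1 - Q (Real.sqrt (p / σ ^ 2)))
    (hU : ∀ p, U p = s * D p - c * p) :
    ∃ pstar : ℝ, 0 < pstar ∧ deriv U pstar = 0
      ∧ Real.exp (-pstar / (2 * σ ^ 2)) / (2 * σ * Real.sqrt (2 * Real.pi * pstar)) = c / s
      ∧ (∀ p : ℝ, 0 < p → p < pstar → 0 < deriv U p)
      ∧ (∀ p : ℝ, pstar < p → deriv U p < 0)
      ∧ (∀ p : ℝ, 0 < p → p ≠ pstar → U p < U pstar)
      ∧ (∀ q : ℝ, 0 < q → deriv U q = 0 → q = pstar) := by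
  set h : ℝ → ℝ := fun p => 2 * σ * √(2 * Real.pi * p) * Real.exp (p / (2 * σ ^ 2)) with hh
  have hpos : ∀ p, 0 < p → 0 < h p := fun p hp => by
    have : 0 < √(2 * Real.pi * p) := Real.sqrt_pos.mpr (by positivity)
    positivity
  have hinv : ∀ p : ℝ,
      Real.exp (-p / (2 * σ ^ 2)) / (2 * σ * √(2 * Real.pi * p)) = (h p)⁻¹ := fun p => by
    rw [neg_div, Real.exp_neg, hh, mul_inv, div_eq_mul_inv, mul_comm]
  have hderiv : ∀ p, 0 < p → HasDerivAt U (s * (h p)⁻¹ - c) p := fun p hp => by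
    have hUeq : U = fun p => s * (1 - (√(2 * Real.pi))⁻¹ *
        ∫ u in Set.Ioi √(p / σ ^ 2), Real.exp (-(u ^ 2) / 2)) - c * p := by
      funext p
      rw [hU, hD, hQ]
    rw [hUeq, ← hinv]
    exact ((hasDerivAt_one_sub_gaussian_tail hσ hp).const_mul s).sub
      (hasDerivAt_const_mul c)
  have hmono : StrictMonoOn h (Set.Ici 0) := strictMonoOn_sqrt_mul_exp hσ
  obtain ⟨r, hr, hrk⟩ : ∃ p, 0 < p ∧ h p = s / c :=
    exists_pos_sqrt_mul_exp_eq hσ (div_pos hs hc)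
  have hleft : ∀ p, 0 < p → p < r → 0 < deriv U p := fun p hp hpr => by
    have hlt : h p < s / c := hrk ▸ hmono hp.le hr.le hpr
    rw [(hderiv p hp).deriv, sub_pos, ← div_eq_mul_inv, lt_div_iff₀ (hpos p hp), mul_comm]
    exact (lt_div_iff₀ hc).mp hlt
  have hright : ∀ p, r < p → deriv U p < 0 := fun p hpr => by
    have hp := hr.trans hpr
    have hlt : s / c < h p := hrk ▸ hmono hr.le hp.le hpr
    rw [(hderiv p hp).deriv, sub_neg, ← div_eq_mul_inv, div_lt_iff₀ (hpos p hp), mul_comm]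
    exact (div_lt_iff₀ hc).mp hlt
  have hcont : ContinuousOn U (Set.Ioi 0) := fun p hp =>
    (hderiv p hp).continuousAt.continuousWithinAt
  refine ⟨r, hr, ?_, ?_, hleft, hright, ?_, ?_⟩
  · rw [(hderiv r hr).deriv, hrk]
    field_simp
    simp
  · rw [hinv, hrk, inv_div]
  · intro p hp hne
    rcases hne.lt_or_gt with hlt | hgt
    · refine strictMonoOn_of_deriv_pos (convex_Ioc 0 r) (hcont.mono fun x hx => hx.1) ?_
        ⟨hp, hlt.le⟩ ⟨hr, le_rfl⟩ hlt
      rw [interior_Ioc]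
      exact fun x hx => hleft x hx.1 hx.2
    · refine strictAntiOn_of_deriv_neg (convex_Ici r) (hcont.mono fun x hx => hr.trans_le hx) ?_
        Set.self_mem_Ici hgt.le hgt
      rw [interior_Ici]
      exact fun x hx => hright x hx
  · intro q hq hq0
    rcases lt_trichotomy q r with hlt | heq | hgt
    · exact absurd hq0 (hleft q hq hlt).ne'
    · exact heq
    · exact absurd hq0 (hright q hgt).ne
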